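/- arXiv:2212.13255 — 7 statements merged into one kernel-verified Lean document; each statement's English description precedes it below -/
import Mathlib

section
/- Let α and x be real numbers. Suppose real sequences (e_n)_{n≥0} and (ζ_n)_{n≥1} satisfy e_0 = 0 and the round-off error propagation recurrence e_{n+1} = ((2n+α+1−x)/(n+1))·e_n − ((n+α)/(n+1))·e_{n−1} + ζ_n for all n ≥ 1. With d_n := e_n − e_{n−1}, the following energy identity holds for every n ≥ 1: x·e_{n+1}² + (n+2−α−x)·d_{n+1}² + (n+α)·(d_{n+1} − d_n)² = x·e_n² + (n+α)·d_n² + 2(n+1)·ζ_n·d_{n+1}. -/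
/-- Energy identity for the round-off error propagation of the standard
three-term recurrence for generalized Laguerre polynomials. -/
theorem laguerre_error_energy_identity
    (α x : ℝ) (e ζ : ℕ → ℝ)
    (he0 : e 0 = 0)
    (hrec : ∀ n : ℕ, 1 ≤ n →
      e (n + 1) = ((2 * (n : ℝ) + α + 1 - x) / ((n : ℝ) + 1)) * e n
        - (((n : ℝ) + α) / ((n : ℝ) + 1)) * e (n - 1) + ζ n)
    (d : ℕ → ℝ)
    (hd : ∀ n : ℕ, 1 ≤ n → d n = e n - e (n - 1)) :
    ∀ n : ℕ, 1 ≤ n →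
      x * (e (n + 1)) ^ 2 + ((n : ℝ) + 2 - α - x) * (d (n + 1)) ^ 2
          + ((n : ℝ) + α) * (d (n + 1) - d n) ^ 2
        = x * (e n) ^ 2 + ((n : ℝ) + α) * (d n) ^ 2
          + 2 * ((n : ℝ) + 1) * ζ n * d (n + 1) := by
  intro n hn
  have hstep : ((n : ℝ) + 1) * (e (n + 1) - e n)
      = ((n : ℝ) + α) * (e n - e (n - 1)) - x * e n + ((n : ℝ) + 1) * ζ n := by
    have hpos : (n : ℝ) + 1 ≠ 0 := by positivity
    rw [hrec n hn]
    field_simp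
    ring
  rw [hd (n + 1) (by omega), hd n hn, Nat.add_sub_cancel]
  linear_combination 2 * (e (n + 1) - e n) * hstep
end

section
/- Let α and x be real numbers and let η > 0. Suppose real sequences (e_n)_{n≥0} and (ζ_n)_{n≥1} satisfy e_0 = 0 and the round-off error propagation recurrence e_{n+1} = ((2n+α+1−x)/(n+1))·e_n − ((n+α)/(n+1))·e_{n−1} + ζ_n for all n ≥ 1. With d_n := e_n − e_{n−1}, for every n ≥ 1: x·e_{n+1}² + (n+2−α−x−η)·d_{n+1}² + (n+α)·(d_{n+1} − d_n)² ≤ x·e_n² + (n+α)·d_n² + ((n+1)²/η)·ζ_n². -/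
/-- Energy inequality (via Cauchy inequality with η) for the round-off error
propagation of the standard three-term recurrence for generalized Laguerre
polynomials. -/
theorem laguerre_error_energy_inequality
    (α x η : ℝ) (hη : 0 < η) (e ζ : ℕ → ℝ)
    (he0 : e 0 = 0)
    (hrec : ∀ n : ℕ, 1 ≤ n →
      e (n + 1) = ((2 * (n : ℝ) + α + 1 - x) / ((n : ℝ) + 1)) * e n
        - (((n : ℝ) + α) / ((n : ℝ) + 1)) * e (n - 1) + ζ n)
    (d : ℕ → ℝ)
    (hd : ∀ n : ℕ, 1 ≤ n → d n = e n - e (n - 1)) :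
    ∀ n : ℕ, 1 ≤ n →
      x * (e (n + 1)) ^ 2 + ((n : ℝ) + 2 - α - x - η) * (d (n + 1)) ^ 2
          + ((n : ℝ) + α) * (d (n + 1) - d n) ^ 2
        ≤ x * (e n) ^ 2 + ((n : ℝ) + α) * (d n) ^ 2
          + (((n : ℝ) + 1) ^ 2 / η) * (ζ n) ^ 2 := by
  intro n hn
  have hD : d (n + 1) = e (n + 1) - e n := by
    simpa using hd (n + 1) (Nat.le_add_left 1 n)
  have hN : (n : ℝ) + 1 ≠ 0 := by positivity
  have step : ((n : ℝ) + 1) * d (n + 1)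
      = ((n : ℝ) + α) * d n - x * e n + ((n : ℝ) + 1) * ζ n := by
    rw [hD, hrec n hn, hd n hn]
    field_simp
    ring
  have energy : x * (e (n + 1)) ^ 2 + ((n : ℝ) + 2 - α - x) * (d (n + 1)) ^ 2
      + ((n : ℝ) + α) * (d (n + 1) - d n) ^ 2
      = x * (e n) ^ 2 + ((n : ℝ) + α) * (d n) ^ 2
        + 2 * (((n : ℝ) + 1) * ζ n) * d (n + 1) := by
    have he : e (n + 1) = e n + d (n + 1) := by rw [hD]; ring
    rw [he]
    linear_combination 2 * d (n + 1) * step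
  have cauchy : 2 * (((n : ℝ) + 1) * ζ n) * d (n + 1)
      ≤ η * (d (n + 1)) ^ 2 + (((n : ℝ) + 1) ^ 2 / η) * (ζ n) ^ 2 := by
    have hsq : 0 ≤ (η * d (n + 1) - ((n : ℝ) + 1) * ζ n) ^ 2 / η := by positivity
    have hexp : (η * d (n + 1) - ((n : ℝ) + 1) * ζ n) ^ 2 / η
        = η * (d (n + 1)) ^ 2 + (((n : ℝ) + 1) ^ 2 / η) * (ζ n) ^ 2
          - 2 * (((n : ℝ) + 1) * ζ n) * d (n + 1) := by
      field_simp
      ring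
    linarith
  linarith
end

section
/- Let α > −1, x > 0, η > 0 be real numbers with 3 − α − x − η > 0. Suppose real sequences (e_n)_{n≥0} and (ζ_n)_{n≥1} satisfy e_0 = 0 and e_{n+1} = ((2n+α+1−x)/(n+1))·e_n − ((n+α)/(n+1))·e_{n−1} + ζ_n for all n ≥ 1. Define d_n := e_n − e_{n−1}, E_n := x·e_n² + (n+α)·d_n² for n ≥ 1, and r_n := max{1, (n+1+α)/(n+2−α−x−η)}. Then for every n ≥ 1: E_{n+1} ≤ r_n·E_n + r_n·((n+1)²/η)·ζ_n². -/
/-- One-step energy estimate `E_{n+1} ≤ r_n E_n + r_n (n+1)²/η ζ_n²` for the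
round-off error propagation of the three-term Laguerre recurrence. -/
theorem laguerre_error_one_step_estimate
    (α x η : ℝ) (hα : -1 < α) (hx : 0 < x) (hη : 0 < η)
    (hcond : 0 < 3 - α - x - η) (e ζ : ℕ → ℝ)
    (he0 : e 0 = 0)
    (hrec : ∀ n : ℕ, 1 ≤ n →
      e (n + 1) = ((2 * (n : ℝ) + α + 1 - x) / ((n : ℝ) + 1)) * e n
        - (((n : ℝ) + α) / ((n : ℝ) + 1)) * e (n - 1) + ζ n)
    (d : ℕ → ℝ) (hd : ∀ n : ℕ, 1 ≤ n → d n = e n - e (n - 1))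
    (E : ℕ → ℝ)
    (hE : ∀ n : ℕ, 1 ≤ n → E n = x * (e n) ^ 2 + ((n : ℝ) + α) * (d n) ^ 2)
    (r : ℕ → ℝ)
    (hr : ∀ n : ℕ, 1 ≤ n →
      r n = max 1 (((n : ℝ) + 1 + α) / ((n : ℝ) + 2 - α - x - η))) :
    ∀ n : ℕ, 1 ≤ n →
      E (n + 1) ≤ r n * E n + r n * (((n : ℝ) + 1) ^ 2 / η) * (ζ n) ^ 2 := by
  intro n hn
  have hn1 : (1 : ℝ) ≤ n := by exact_mod_cast hn
  have hm : (0 : ℝ) < (n : ℝ) + 1 := by linarith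
  have hc : 0 < (n : ℝ) + α := by linarith
  have hq : 0 < (n : ℝ) + 2 - α - x - η := by linarith
  have hr_one : 1 ≤ r n := by rw [hr n hn]; exact le_max_left _ _
  have hr_ratio : (n : ℝ) + 1 + α ≤ r n * ((n : ℝ) + 2 - α - x - η) := by
    rw [← div_le_iff₀ hq, hr n hn]
    exact le_max_right _ _
  have hd_succ : d (n + 1) = e (n + 1) - e n := hd (n + 1) (by omega)
  have he_succ : e (n + 1) = e n + d (n + 1) := by rw [hd_succ]; ring
  -- The recurrence in terms of the differences.
  have hd_rec : ((n : ℝ) + 1) * d (n + 1)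
      = -x * e n + ((n : ℝ) + α) * d n + ((n : ℝ) + 1) * ζ n := by
    rw [hd_succ, hd n hn, hrec n hn]
    field_simp
    ring
  have hyoung : 2 * d (n + 1) * (((n : ℝ) + 1) * ζ n)
      ≤ ((n : ℝ) + 1) ^ 2 / η * ζ n ^ 2 + η * d (n + 1) ^ 2 := by
    have h : ((n : ℝ) + 1) ^ 2 / η * ζ n ^ 2 + η * d (n + 1) ^ 2
        - 2 * d (n + 1) * (((n : ℝ) + 1) * ζ n)
        = (((n : ℝ) + 1) * ζ n - η * d (n + 1)) ^ 2 / η := by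
      field_simp
      ring
    have h_nonneg : 0 ≤ (((n : ℝ) + 1) * ζ n - η * d (n + 1)) ^ 2 / η := by positivity
    linarith
  have hsq : 0 ≤ ((n : ℝ) + α) * (d n - d (n + 1)) ^ 2 :=
    mul_nonneg hc.le (sq_nonneg _)
  have hlower : x * e (n + 1) ^ 2 + ((n : ℝ) + 2 - α - x - η) * d (n + 1) ^ 2
      ≤ E n + ((n : ℝ) + 1) ^ 2 / η * ζ n ^ 2 := by
    rw [hE n hn, he_succ]
    linear_combination hsq + hyoung + 2 * d (n + 1) * hd_rec
  calc
    E (n + 1) = x * e (n + 1) ^ 2 + ((n : ℝ) + 1 + α) * d (n + 1) ^ 2 := by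
      rw [hE (n + 1) (by omega)]
      push_cast
      ring
    _ ≤ r n * (x * e (n + 1) ^ 2)
        + r n * ((n : ℝ) + 2 - α - x - η) * d (n + 1) ^ 2 := by
      refine add_le_add (le_mul_of_one_le_left (by positivity) hr_one) ?_
      gcongr
    _ = r n * (x * e (n + 1) ^ 2 + ((n : ℝ) + 2 - α - x - η) * d (n + 1) ^ 2) := by ring
    _ ≤ r n * (E n + ((n : ℝ) + 1) ^ 2 / η * ζ n ^ 2) := by gcongr
    _ = r n * E n + r n * (((n : ℝ) + 1) ^ 2 / η) * ζ n ^ 2 := by ring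
end

section
/- Let α > −1, x > 0, η > 0 be real numbers with 3 − α − x − η > 0 and 1 − 2α − x − η ≥ 0. Suppose real sequences (e_n)_{n≥0} and (ζ_n)_{n≥1} satisfy e_0 = 0 and e_{n+1} = ((2n+α+1−x)/(n+1))·e_n − ((n+α)/(n+1))·e_{n−1} + ζ_n for all n ≥ 1. Define E_n := x·e_n² + (n+α)·(e_n − e_{n−1})². Then for every n ≥ 1: E_{n+1} ≤ E_1 + ((n+1)(n+2)(2n+3)/(6η))·max_{1≤s≤n} ζ_s². -/
/-- One step of the recurrence increases the energy by at most `(n+1)² ζ_n² / η`. Here `a`, `b`, `c`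
stand for `e_{n-1}`, `e_n`, `e_{n+1}`. -/
theorem laguerre_energy_step {α x η m a b c z : ℝ} (hη : 0 < η) (hm : 0 < m + 1) (hmα : 0 ≤ m + α)
    (hcase : 0 ≤ 1 - 2 * α - x - η)
    (hrec : c = ((2 * m + α + 1 - x) / (m + 1)) * b - ((m + α) / (m + 1)) * a + z) :
    x * c ^ 2 + (m + 1 + α) * (c - b) ^ 2
      ≤ x * b ^ 2 + (m + α) * (b - a) ^ 2 + (m + 1) ^ 2 / η * z ^ 2 := by
  have hlin : (m + 1) * (c - b) = (m + α) * (b - a) - x * b + (m + 1) * z := by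
    rw [hrec]
    field_simp
    ring
  have hxb : x * b = (m + α) * (b - a) - (m + 1) * (c - b) + (m + 1) * z := by linarith
  have hdiff : x * c ^ 2 + (m + 1 + α) * (c - b) ^ 2 - (x * b ^ 2 + (m + α) * (b - a) ^ 2)
      = -((m + α) * (c - 2 * b + a) ^ 2) - (1 - 2 * α - x) * (c - b) ^ 2
        + 2 * (m + 1) * z * (c - b) := by
    linear_combination 2 * (c - b) * hxb
  have hyoung : 2 * (m + 1) * z * (c - b) ≤ η * (c - b) ^ 2 + (m + 1) ^ 2 / η * z ^ 2 := by
    have hsq : η * (c - b) ^ 2 + (m + 1) ^ 2 / η * z ^ 2 - 2 * (m + 1) * z * (c - b)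
        = (η * (c - b) - (m + 1) * z) ^ 2 / η := by
      field_simp
      ring
    have : 0 ≤ (η * (c - b) - (m + 1) * z) ^ 2 / η := by positivity
    linarith
  have hpos : 0 ≤ (m + α) * (c - 2 * b + a) ^ 2 := by positivity
  have hpos' : 0 ≤ (1 - 2 * α - x - η) * (c - b) ^ 2 := by positivity
  linarith

open Finset in
/-- First case of the main error-propagation theorem: when
`1 - 2α - x - η ≥ 0`, the energy satisfies
`E_{n+1} ≤ E_1 + ((n+1)(n+2)(2n+3)/(6η)) max_{1≤s≤n} ζ_s²`. -/
theorem laguerre_error_propagation_case_one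
    (α x η : ℝ) (hα : -1 < α) (hx : 0 < x) (hη : 0 < η)
    (hcond : 0 < 3 - α - x - η) (hcase : 0 ≤ 1 - 2 * α - x - η)
    (e ζ : ℕ → ℝ)
    (he0 : e 0 = 0)
    (hrec : ∀ n : ℕ, 1 ≤ n →
      e (n + 1) = ((2 * (n : ℝ) + α + 1 - x) / ((n : ℝ) + 1)) * e n
        - (((n : ℝ) + α) / ((n : ℝ) + 1)) * e (n - 1) + ζ n)
    (E : ℕ → ℝ)
    (hE : ∀ n : ℕ, 1 ≤ n →
      E n = x * (e n) ^ 2 + ((n : ℝ) + α) * (e n - e (n - 1)) ^ 2) :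
    ∀ n : ℕ, ∀ hn : 1 ≤ n,
      E (n + 1) ≤ E 1
        + (((n : ℝ) + 1) * ((n : ℝ) + 2) * (2 * (n : ℝ) + 3) / (6 * η))
          * ((Icc 1 n).sup' (Finset.nonempty_Icc.mpr hn)
              (fun s => (ζ s) ^ 2)) := by
  have step : ∀ n : ℕ, 1 ≤ n → E (n + 1) ≤ E n + ((n : ℝ) + 1) ^ 2 / η * ζ n ^ 2 := by
    intro n hn
    have hn' : (1 : ℝ) ≤ n := by exact_mod_cast hn
    rw [hE (n + 1) (by omega), hE n hn, Nat.add_sub_cancel]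
    push_cast
    exact laguerre_energy_step hη (by linarith) (by linarith) hcase (hrec n hn)
  have bound : ∀ M : ℝ, ∀ n : ℕ, 1 ≤ n → (∀ s ∈ Icc 1 n, ζ s ^ 2 ≤ M) →
      E (n + 1) ≤ E 1
        + (((n : ℝ) + 1) * ((n : ℝ) + 2) * (2 * (n : ℝ) + 3) / (6 * η) - 1 / η) * M := by
    intro M n hn
    induction n, hn using Nat.le_induction with
    | base =>
      intro hM
      have h := step 1 le_rfl
      have hle : (((1 : ℕ) : ℝ) + 1) ^ 2 / η * ζ 1 ^ 2 ≤ (((1 : ℕ) : ℝ) + 1) ^ 2 / η * M :=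
        mul_le_mul_of_nonneg_left (hM 1 (by simp)) (by positivity)
      refine (h.trans (add_le_add le_rfl hle)).trans_eq ?_
      push_cast
      field_simp
      ring
    | succ n hn ih =>
      intro hM
      have ih := ih fun s hs => hM s (Icc_subset_Icc_right n.le_succ hs)
      have h := step (n + 1) (by omega)
      have hle : (((n + 1 : ℕ) : ℝ) + 1) ^ 2 / η * ζ (n + 1) ^ 2
          ≤ (((n + 1 : ℕ) : ℝ) + 1) ^ 2 / η * M :=
        mul_le_mul_of_nonneg_left (hM (n + 1) (by simp)) (by positivity)
      refine (h.trans (add_le_add ih hle)).trans_eq ?_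
      push_cast
      field_simp
      ring
  intro n hn
  have hle : ∀ s ∈ Icc 1 n, ζ s ^ 2 ≤ (Icc 1 n).sup' (Finset.nonempty_Icc.mpr hn)
      (fun s => (ζ s) ^ 2) := fun s hs => le_sup' (fun s => (ζ s) ^ 2) hs
  have hM := (sq_nonneg (ζ 1)).trans (hle 1 (by simp [hn]))
  refine (bound _ n hn hle).trans ?_
  gcongr
  exact sub_le_self _ (by positivity)
end

section
/- Let α and x be real numbers with −1 < α ≤ 1/4 and 0 < x < 1/4. Suppose real sequences (e_n)_{n≥0} and (ζ_n)_{n≥1} satisfy e_0 = 0 and e_{n+1} = ((2n+α+1−x)/(n+1))·e_n − ((n+α)/(n+1))·e_{n−1} + ζ_n for all n ≥ 1. Then for every n ≥ 1: |e_{n+1}| ≤ √( (1/x)·( (1+α+x)·e_1² + (2(n+1)(n+2)(2n+3)/3)·max_{1≤s≤n} ζ_s² ) ). -/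
/-- One step of the recurrence raises the energy `(n + α) (eₙ - eₙ₋₁)² + x eₙ²`
by at most `4 (n + 1)² ζₙ²`. Here `p`, `y`, `w` stand for `eₙ₋₁`, `eₙ`, `eₙ₊₁`, and `t` for `n`. -/
lemma laguerre_energy_step_s7 {α x t p y w z : ℝ} (hα1 : -1 < α) (hα2 : α ≤ 1 / 4) (hx : x < 1 / 4)
    (ht : 1 ≤ t) (hw : w = ((2 * t + α + 1 - x) / (t + 1)) * y - ((t + α) / (t + 1)) * p + z) :
    (t + 1 + α) * (w - y) ^ 2 + x * w ^ 2 ≤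
      (t + α) * (y - p) ^ 2 + x * y ^ 2 + 4 * (t + 1) ^ 2 * z ^ 2 := by
  have ht0 : t + 1 ≠ 0 := by linarith
  have key : (t + 1) * (w - y) = (t + α) * (y - p) - x * y + (t + 1) * z := by
    rw [hw]
    field_simp
    ring
  have hid : (t + α) * (y - p) ^ 2 + x * y ^ 2 + 4 * (t + 1) ^ 2 * z ^ 2
      - ((t + 1 + α) * (w - y) ^ 2 + x * w ^ 2)
      = (t + α) * (w - y - (y - p)) ^ 2 + (3 / 4 - 2 * α - x) * (w - y) ^ 2
        + ((w - y) / 2 - 2 * (t + 1) * z) ^ 2 := by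
    linear_combination (-2 * (w - y)) * key
  have h1 : 0 ≤ (t + α) * (w - y - (y - p)) ^ 2 := mul_nonneg (by linarith) (sq_nonneg _)
  have h2 : 0 ≤ (3 / 4 - 2 * α - x) * (w - y) ^ 2 := mul_nonneg (by linarith) (sq_nonneg _)
  linarith [sq_nonneg ((w - y) / 2 - 2 * (t + 1) * z)]

open Finset in
/-- First bound of Theorem 3.2: for `-1 < α ≤ 1/4` and `0 < x < 1/4`,
`|e_{n+1}| ≤ √((1/x)((1+α+x)e_1² + (2(n+1)(n+2)(2n+3)/3) max_s ζ_s²))`. -/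
theorem laguerre_error_bound_case_one
    (α x : ℝ) (hα1 : -1 < α) (hα2 : α ≤ 1 / 4) (hx0 : 0 < x) (hx : x < 1 / 4)
    (e ζ : ℕ → ℝ)
    (he0 : e 0 = 0)
    (hrec : ∀ n : ℕ, 1 ≤ n →
      e (n + 1) = ((2 * (n : ℝ) + α + 1 - x) / ((n : ℝ) + 1)) * e n
        - (((n : ℝ) + α) / ((n : ℝ) + 1)) * e (n - 1) + ζ n) :
    ∀ n : ℕ, ∀ hn : 1 ≤ n,
      |e (n + 1)| ≤ Real.sqrt ((1 / x) * ((1 + α + x) * (e 1) ^ 2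
        + (2 * ((n : ℝ) + 1) * ((n : ℝ) + 2) * (2 * (n : ℝ) + 3) / 3)
          * ((Icc 1 n).sup' (Finset.nonempty_Icc.mpr hn)
              (fun s => (ζ s) ^ 2)))) := by
  intro n hn
  set M := (Icc 1 n).sup' (Finset.nonempty_Icc.mpr hn) (fun s => (ζ s) ^ 2)
  have hM : ∀ s, 1 ≤ s → s ≤ n → ζ s ^ 2 ≤ M := fun s h1 h2 =>
    Finset.le_sup' (fun s => (ζ s) ^ 2) (Finset.mem_Icc.mpr ⟨h1, h2⟩)
  have hM0 : 0 ≤ M := (sq_nonneg _).trans (hM 1 le_rfl hn)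
  have energy : ∀ k : ℕ, k ≤ n →
      ((k : ℝ) + 1 + α) * (e (k + 1) - e k) ^ 2 + x * e (k + 1) ^ 2 ≤
        (1 + α + x) * e 1 ^ 2
          + (2 * ((k : ℝ) + 1) * ((k : ℝ) + 2) * (2 * (k : ℝ) + 3) / 3) * M := by
    intro k
    induction k with
    | zero =>
      intro _
      simp only [Nat.cast_zero, zero_add, he0, sub_zero]
      linarith
    | succ k ih =>
      intro hk
      have h := ih (by omega)
      have hr := hrec (k + 1) (by omega)
      rw [Nat.add_sub_cancel] at hr
      push_cast at hr ⊢
      have hs := laguerre_energy_step_s7 hα1 hα2 hx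
        (by linarith [k.cast_nonneg (α := ℝ)] : (1 : ℝ) ≤ (k : ℝ) + 1) hr
      have hz := mul_le_mul_of_nonneg_left (hM (k + 1) (by omega) hk)
        (by positivity : (0 : ℝ) ≤ 4 * ((k : ℝ) + 1 + 1) ^ 2)
      linarith
  have hE := energy n le_rfl
  have hd : 0 ≤ ((n : ℝ) + 1 + α) * (e (n + 1) - e n) ^ 2 :=
    mul_nonneg (by linarith [n.cast_nonneg (α := ℝ)]) (sq_nonneg _)
  apply Real.abs_le_sqrt
  rw [one_div_mul_eq_div, le_div_iff₀ hx0]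
  linarith
end

section
/- Let α and x be real numbers with −1 < α ≤ 1/4 and 0 < x < 1/4. Suppose real sequences (e_n)_{n≥0} and (ζ_n)_{n≥1} satisfy e_0 = 0 and e_{n+1} = ((2n+α+1−x)/(n+1))·e_n − ((n+α)/(n+1))·e_{n−1} + ζ_n for all n ≥ 1. Then for every n ≥ 1: |e_{n+1}| ≤ (2 + 2(n+2)^{3/2}/√3)·max{|e_1|, max_{1≤s≤n}|ζ_s|}/√x. -/
/-- The homogeneous Laguerre step increases the energy `k d² + x e (e - d)`, where `d` is the
backward difference of `e`, by a factor of at most `1 + 1 / (k + 1)`. -/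
lemma laguerre_energy_homogeneous_step {α x k a b p : ℝ} (hα1 : -1 < α) (hα2 : α ≤ 1 / 4)
    (hx0 : 0 < x) (hx : x < 1 / 4) (hk : 1 ≤ k)
    (hp : (k + 1) * p = (k + α) * (b - a) - x * b) :
    (k + 1) * ((k + 1) * p ^ 2 + x * (b + p) * b)
      ≤ (k + 2) * (k * (b - a) ^ 2 + x * b * a) := by
  obtain ⟨d, rfl⟩ : ∃ d, a = b - d := ⟨b - a, by ring⟩
  have hform : 0 ≤ x * b ^ 2 - (2 - α) * x * b * d + (k * (2 - 2 * α) - α ^ 2) * d ^ 2 := by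
    have hcoef : x * (2 - α) ^ 2 / 4 ≤ k * (2 - 2 * α) - α ^ 2 := by
      have h9 : (2 - α) ^ 2 ≤ 9 := by nlinarith
      have hxα : x * (2 - α) ^ 2 ≤ 9 / 4 := by nlinarith [sq_nonneg (2 - α)]
      nlinarith
    have hsq : 0 ≤ x * (b - (2 - α) / 2 * d) ^ 2 := by positivity
    nlinarith [mul_le_mul_of_nonneg_right hcoef (sq_nonneg d)]
  have hdiff : (k + 2) * (k * (b - (b - d)) ^ 2 + x * b * (b - d))
      - (k + 1) * ((k + 1) * p ^ 2 + x * (b + p) * b)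
      = x * b ^ 2 - (2 - α) * x * b * d + (k * (2 - 2 * α) - α ^ 2) * d ^ 2 := by
    linear_combination (-((k + 1) * p + (k + α) * d - x * b) - x * b) * hp
  linarith

/-- One perturbed Laguerre step preserves the energy bound `M² (k + 1)³`. -/
lemma laguerre_energy_step_s8 {α x k a b c z M : ℝ} (hα1 : -1 < α) (hα2 : α ≤ 1 / 4)
    (hx0 : 0 < x) (hx : x < 1 / 4) (hk : 1 ≤ k) (hz : |z| ≤ M)
    (hE : k * (b - a) ^ 2 + x * b * a ≤ M ^ 2 * (k + 1) ^ 3)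
    (hc : (k + 1) * (c - b) = (k + α) * (b - a) - x * b + (k + 1) * z) :
    (k + 1) * (c - b) ^ 2 + x * c * b ≤ M ^ 2 * (k + 2) ^ 3 := by
  obtain ⟨p, rfl⟩ : ∃ p, c = b + p + z := ⟨c - b - z, by ring⟩
  have hM : 0 ≤ M := (abs_nonneg z).trans hz
  have hhom := laguerre_energy_homogeneous_step (a := a) (b := b) (p := p) hα1 hα2 hx0 hx hk
    (by linear_combination hc)
  have hV : (k + 1) * p ^ 2 + x * (b + p) * b ≤ M ^ 2 * ((k + 1) * (k + 3 / 2) ^ 2) := by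
    have h1 : (k + 1) * ((k + 1) * p ^ 2 + x * (b + p) * b)
        ≤ (k + 1) * (M ^ 2 * ((k + 2) * (k + 1) ^ 2)) :=
      hhom.trans ((mul_le_mul_of_nonneg_left hE (by linarith)).trans_eq (by ring))
    refine (le_of_mul_le_mul_left h1 (by linarith)).trans ?_
    refine mul_le_mul_of_nonneg_left ?_ (sq_nonneg M)
    nlinarith
  have hB : |(k + 1) * p + x * b / 2| ≤ M * ((k + 1) * (k + 3 / 2)) := by
    refine abs_le_of_sq_le_sq ?_ (by positivity)
    have hb : 0 ≤ x * (k + 1 - x / 4) * b ^ 2 :=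
      mul_nonneg (mul_nonneg hx0.le (by linarith)) (sq_nonneg b)
    nlinarith [mul_le_mul_of_nonneg_left hV (by linarith : (0 : ℝ) ≤ k + 1)]
  have hBz : ((k + 1) * p + x * b / 2) * z ≤ M * ((k + 1) * (k + 3 / 2)) * M := by
    refine (le_abs_self _).trans ?_
    rw [abs_mul]
    gcongr
  have hz2 : (k + 1) * z ^ 2 ≤ (k + 1) * M ^ 2 := by
    refine mul_le_mul_of_nonneg_left (sq_le_sq' ?_ ?_) (by linarith) <;>
      linarith [neg_abs_le z, le_abs_self z]
  have hMk : 0 ≤ M ^ 2 * (3 / 4 * k + 7 / 4) := by positivity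
  nlinarith

/-- The energy of a perturbed Laguerre recurrence started at `e 0 = 0` grows at most cubically. -/
lemma laguerre_energy_le {α x M : ℝ} (hα1 : -1 < α) (hα2 : α ≤ 1 / 4) (hx0 : 0 < x)
    (hx : x < 1 / 4) {e ζ : ℕ → ℝ} (he0 : e 0 = 0)
    (hrec : ∀ n : ℕ, 1 ≤ n →
      e (n + 1) = ((2 * (n : ℝ) + α + 1 - x) / ((n : ℝ) + 1)) * e n
        - (((n : ℝ) + α) / ((n : ℝ) + 1)) * e (n - 1) + ζ n)
    (he1 : |e 1| ≤ M) (n : ℕ) (hζ : ∀ s, 1 ≤ s → s ≤ n → |ζ s| ≤ M) :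
    ((n : ℝ) + 1) * (e (n + 1) - e n) ^ 2 + x * e (n + 1) * e n ≤ M ^ 2 * ((n : ℝ) + 2) ^ 3 := by
  induction n with
  | zero =>
    have h : e 1 ^ 2 ≤ M ^ 2 := sq_le_sq' (by linarith [neg_abs_le (e 1)])
      (by linarith [le_abs_self (e 1)])
    simp only [he0, Nat.cast_zero, zero_add]
    nlinarith [sq_nonneg M]
  | succ n ih =>
    have hn : (0 : ℝ) ≤ n := n.cast_nonneg
    have hE := ih fun s h1 h2 => hζ s h1 (h2.trans n.le_succ)
    have h := hrec (n + 1) (by omega)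
    have hstep := laguerre_energy_step_s8 (k := (n : ℝ) + 1) (a := e n) (b := e (n + 1))
      (c := e (n + 1 + 1)) (α := α) hα1 hα2 hx0 hx (by linarith) (hζ (n + 1) (by omega) le_rfl)
      (hE.trans_eq (by ring)) (by
        rw [h, Nat.add_sub_cancel]
        push_cast
        field_simp
        ring)
    push_cast
    exact hstep


open Finset in
/-- Simplified first bound of Theorem 3.2: for `-1 < α ≤ 1/4`, `0 < x < 1/4`,
`|e_{n+1}| ≤ (2 + 2(n+2)^{3/2}/√3) max{|e_1|, max_s |ζ_s|} / √x`. -/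
theorem laguerre_error_bound_case_one_simplified
    (α x : ℝ) (hα1 : -1 < α) (hα2 : α ≤ 1 / 4) (hx0 : 0 < x) (hx : x < 1 / 4)
    (e ζ : ℕ → ℝ)
    (he0 : e 0 = 0)
    (hrec : ∀ n : ℕ, 1 ≤ n →
      e (n + 1) = ((2 * (n : ℝ) + α + 1 - x) / ((n : ℝ) + 1)) * e n
        - (((n : ℝ) + α) / ((n : ℝ) + 1)) * e (n - 1) + ζ n) :
    ∀ n : ℕ, ∀ hn : 1 ≤ n,
      |e (n + 1)| ≤ (2 + 2 * ((n : ℝ) + 2) ^ ((3 : ℝ) / 2) / Real.sqrt 3)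
        * max |e 1| ((Icc 1 n).sup' (Finset.nonempty_Icc.mpr hn)
            (fun s => |ζ s|))
        / Real.sqrt x := by
  intro n hn
  set M := max |e 1| ((Icc 1 n).sup' (Finset.nonempty_Icc.mpr hn) (fun s => |ζ s|))
  have hζ : ∀ s, 1 ≤ s → s ≤ n → |ζ s| ≤ M := fun s h1 h2 =>
    (Finset.le_sup' (fun s => |ζ s|) (mem_Icc.mpr ⟨h1, h2⟩)).trans (le_max_right _ _)
  have hM : 0 ≤ M := (abs_nonneg _).trans (le_max_left _ _)
  have hE := laguerre_energy_le hα1 hα2 hx0 hx he0 hrec (le_max_left _ _ : |e 1| ≤ M) n hζ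
  have hn0 : (0 : ℝ) ≤ n := n.cast_nonneg
  have hlow : x * e (n + 1) ^ 2 ≤ 4 / 3 * (M ^ 2 * ((n : ℝ) + 2) ^ 3) := by
    have hd : 0 ≤ (e (n + 1) - e n - x / 2 * e (n + 1)) ^ 2 := sq_nonneg _
    have hnd : 0 ≤ (n : ℝ) * (e (n + 1) - e n) ^ 2 := by positivity
    have hxe : 0 ≤ x * (1 / 4 - x / 4) * e (n + 1) ^ 2 :=
      mul_nonneg (mul_nonneg hx0.le (by linarith)) (sq_nonneg _)
    nlinarith
  have hpow : (((n : ℝ) + 2) ^ ((3 : ℝ) / 2)) ^ 2 = ((n : ℝ) + 2) ^ 3 := by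
    rw [← Real.rpow_natCast, ← Real.rpow_mul (by positivity), ← Real.rpow_natCast]
    norm_num
  rw [le_div_iff₀ (Real.sqrt_pos.mpr hx0)]
  have hmain : |e (n + 1) * √x| ≤ 2 * ((n : ℝ) + 2) ^ ((3 : ℝ) / 2) / √3 * M := by
    refine abs_le_of_sq_le_sq ?_ (by positivity)
    rw [mul_pow, Real.sq_sqrt hx0.le, mul_pow, div_pow, mul_pow, hpow,
      Real.sq_sqrt (by norm_num)]
    linarith
  rw [abs_mul, abs_of_nonneg (Real.sqrt_nonneg x)] at hmain
  linarith
end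

section
/- Let α and x be real numbers. Suppose real sequences (e_n)_{n≥0}, (d_n)_{n≥1}, and (ζ_n)_{n≥1} satisfy e_0 = 0, d_1 = e_1, and for every n ≥ 1: d_{n+1} = ((n+α)/(n+1))·d_n − (x/(n+1))·e_n + ζ_n and e_{n+1} = e_n + d_{n+1}. Then d_n = e_n − e_{n−1} for all n ≥ 1, and for every n ≥ 1: e_{n+1} = ((2n+α+1−x)/(n+1))·e_n − ((n+α)/(n+1))·e_{n−1} + ζ_n. -/
/-- The error propagation of the modified three-term recurrence: the coupled
system for `(d_n, e_n)` implies `d_n = e_n - e_{n-1}` and the same error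
equation as the standard three-term recurrence. -/
theorem modified_recurrence_error_propagation
    (α x : ℝ) (e d ζ : ℕ → ℝ)
    (he0 : e 0 = 0) (hd1 : d 1 = e 1)
    (hdrec : ∀ n : ℕ, 1 ≤ n →
      d (n + 1) = (((n : ℝ) + α) / ((n : ℝ) + 1)) * d n
        - (x / ((n : ℝ) + 1)) * e n + ζ n)
    (herec : ∀ n : ℕ, 1 ≤ n → e (n + 1) = e n + d (n + 1)) :
    (∀ n : ℕ, 1 ≤ n → d n = e n - e (n - 1))
    ∧ (∀ n : ℕ, 1 ≤ n →
        e (n + 1) = ((2 * (n : ℝ) + α + 1 - x) / ((n : ℝ) + 1)) * e n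
          - (((n : ℝ) + α) / ((n : ℝ) + 1)) * e (n - 1) + ζ n) := by
  have hd : ∀ n : ℕ, 1 ≤ n → d n = e n - e (n - 1) := by
    intro n hn
    induction n, hn using Nat.le_induction with
    | base => simp [he0, hd1]
    | succ n hn _ =>
      rw [Nat.add_sub_cancel, herec n hn]
      ring
  refine ⟨hd, fun n hn => ?_⟩
  have hpos : (n : ℝ) + 1 ≠ 0 := by positivity
  rw [herec n hn, hdrec n hn, hd n hn]
  field_simp
  ring
end
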